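/- Let ε > 0, α ∈ (0,1), N ∈ ℕ with (1−α)·N ∉ ℤ, Γ_ε the quartic-kernel smoothed indicator, and Q_ε : ℝ^N → ℝ the map sending z to the unique root Q of Σ_{i=1}^N Γ_ε(z_i − Q) = (1−α)·N. Then there exists ε₀ ∈ (0, ε) such that for every z ∈ ℝ^N: (i) Σ_{j=1}^N Γ_ε'(z_j − Q_ε(z)) ≤ γ_ε'(ε₀) < 0, and (ii) the gradient of Q_ε at z is given componentwise by [∇Q_ε(z)]_i = Γ_ε'(z_i − Q_ε(z)) / (Σ_{j=1}^N Γ_ε'(z_j − Q_ε(z))), with 0 ≤ [∇Q_ε(z)]_i ≤ 1 for every i. -/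

import Mathlib

/-- The quartic kernel smoothing function `γ_ε`. -/
noncomputable def quarticGamma (ε : ℝ) (y : ℝ) : ℝ :=
  (15/16) * (-(1/5) * (y/ε)^5 + (2/3) * (y/ε)^3 - (y/ε) + 8/15)

/-- The quartic-kernel smoothed indicator function `Γ_ε`. -/
noncomputable def quarticInd (ε : ℝ) (y : ℝ) : ℝ :=
  if y ≤ -ε then 1
  else if y < ε then quarticGamma ε y
  else 0

open Filter Topology

lemma hasDerivAt_quarticGamma {ε : ℝ} (hε : 0 < ε) (y : ℝ) :
    HasDerivAt (quarticGamma ε) (-(15 / 16) / ε * (1 - (y / ε) ^ 2) ^ 2) y := by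
  have h : HasDerivAt (fun x : ℝ => x / ε) (1 / ε) y := (hasDerivAt_id y).div_const ε
  have := (((((h.pow 5).const_mul (-(1 / 5) : ℝ)).add ((h.pow 3).const_mul (2 / 3 : ℝ))).sub
    h).add_const (8 / 15 : ℝ)).const_mul (15 / 16 : ℝ)
  refine this.congr_deriv ?_
  norm_num
  field_simp
  ring

lemma quarticGamma_neg (ε y : ℝ) : quarticGamma ε (-y) = 1 - quarticGamma ε y := by
  unfold quarticGamma
  ring

lemma quarticGamma_self {ε : ℝ} (hε : 0 < ε) : quarticGamma ε ε = 0 := by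
  unfold quarticGamma
  rw [div_self hε.ne']
  norm_num

/-- The derivative of `quarticInd ε`. -/
noncomputable def quarticIndDeriv (ε y : ℝ) : ℝ :=
  -(15 / 16) / ε * (max 0 (1 - (y / ε) ^ 2)) ^ 2

lemma continuous_quarticIndDeriv (ε : ℝ) : Continuous (quarticIndDeriv ε) := by
  unfold quarticIndDeriv
  fun_prop

lemma quarticIndDeriv_nonpos {ε : ℝ} (hε : 0 < ε) (y : ℝ) : quarticIndDeriv ε y ≤ 0 := by
  unfold quarticIndDeriv
  have : 0 ≤ (15 / 16) / ε * (max 0 (1 - (y / ε) ^ 2)) ^ 2 := by positivity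
  rw [neg_div, neg_mul]
  linarith

lemma quarticIndDeriv_of_abs_le {ε y : ℝ} (hε : 0 < ε) (hy : |y| ≤ ε) :
    quarticIndDeriv ε y = -(15 / 16) / ε * (1 - (y / ε) ^ 2) ^ 2 := by
  unfold quarticIndDeriv
  rw [max_eq_right]
  rw [sub_nonneg, sq_le_one_iff_abs_le_one, abs_div, abs_of_pos hε]
  exact div_le_one_of_le₀ hy hε.le

lemma quarticIndDeriv_of_le_abs {ε y : ℝ} (hε : 0 < ε) (hy : ε ≤ |y|) :
    quarticIndDeriv ε y = 0 := by
  unfold quarticIndDeriv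
  rw [max_eq_left]
  · simp
  · rw [sub_nonpos, one_le_sq_iff_one_le_abs, abs_div, abs_of_pos hε]
    exact (one_le_div hε).2 hy

lemma quarticInd_of_le_neg {ε y : ℝ} (hy : y ≤ -ε) : quarticInd ε y = 1 := if_pos hy

lemma quarticInd_of_ge {ε y : ℝ} (hε : 0 < ε) (hy : ε ≤ y) : quarticInd ε y = 0 := by
  unfold quarticInd
  rw [if_neg (by linarith), if_neg (by linarith)]

lemma quarticInd_of_abs_le {ε y : ℝ} (hε : 0 < ε) (hy : |y| ≤ ε) :
    quarticInd ε y = quarticGamma ε y := by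
  obtain ⟨h1, h2⟩ := abs_le.1 hy
  rcases h1.eq_or_lt with rfl | h1
  · rw [quarticInd_of_le_neg le_rfl, quarticGamma_neg, quarticGamma_self hε, sub_zero]
  rcases h2.eq_or_lt with rfl | h2
  · rw [quarticInd_of_ge hε le_rfl, quarticGamma_self hε]
  · unfold quarticInd
    rw [if_neg (by linarith), if_pos h2]

lemma hasDerivAt_quarticInd {ε : ℝ} (hε : 0 < ε) (y : ℝ) :
    HasDerivAt (quarticInd ε) (quarticIndDeriv ε y) y := by
  have hmid : ∀ y, |y| ≤ ε →
      HasDerivWithinAt (quarticInd ε) (quarticIndDeriv ε y) (Set.Icc (-ε) ε) y := by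
    intro y hy
    rw [quarticIndDeriv_of_abs_le hε hy]
    exact (hasDerivAt_quarticGamma hε y).hasDerivWithinAt.congr
      (fun x hx => quarticInd_of_abs_le hε (abs_le.2 hx)) (quarticInd_of_abs_le hε hy)
  have hleft : ∀ y, y ≤ -ε →
      HasDerivWithinAt (quarticInd ε) (quarticIndDeriv ε y) (Set.Iic (-ε)) y := by
    intro y hy
    rw [quarticIndDeriv_of_le_abs hε (le_abs.2 (Or.inr (by linarith)))]
    exact (hasDerivWithinAt_const y _ (1 : ℝ)).congr
      (fun x hx => quarticInd_of_le_neg hx) (quarticInd_of_le_neg hy)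
  have hright : ∀ y, ε ≤ y →
      HasDerivWithinAt (quarticInd ε) (quarticIndDeriv ε y) (Set.Ici ε) y := by
    intro y hy
    rw [quarticIndDeriv_of_le_abs hε (le_abs.2 (Or.inl hy))]
    exact (hasDerivWithinAt_const y _ (0 : ℝ)).congr
      (fun x hx => quarticInd_of_ge hε hx) (quarticInd_of_ge hε hy)
  rcases lt_trichotomy y (-ε) with h | rfl | h
  · exact (hleft y h.le).hasDerivAt (Iic_mem_nhds h)
  · refine ((hleft _ le_rfl).union (hmid (-ε) (by rw [abs_neg, abs_of_pos hε]))).hasDerivAt ?_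
    rw [Set.Iic_union_Icc_eq_Iic (by linarith)]
    exact Iic_mem_nhds (by linarith)
  rcases lt_trichotomy y ε with h' | rfl | h'
  · exact (hmid y (abs_le.2 ⟨h.le, h'.le⟩)).hasDerivAt (Icc_mem_nhds h h')
  · refine ((hmid y (abs_of_pos hε).le).union (hright y le_rfl)).hasDerivAt ?_
    rw [Set.Icc_union_Ici_eq_Ici (by linarith)]
    exact Ici_mem_nhds h
  · exact (hright y h'.le).hasDerivAt (Ici_mem_nhds h')

lemma hasStrictDerivAt_quarticInd {ε : ℝ} (hε : 0 < ε) (y : ℝ) :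
    HasStrictDerivAt (quarticInd ε) (quarticIndDeriv ε y) y :=
  hasStrictDerivAt_of_hasDerivAt_of_continuousAt
    (Eventually.of_forall (hasDerivAt_quarticInd hε)) (continuous_quarticIndDeriv ε).continuousAt

lemma antitone_quarticInd {ε : ℝ} (hε : 0 < ε) : Antitone (quarticInd ε) :=
  antitone_of_hasDerivAt_nonpos (hasDerivAt_quarticInd hε) (quarticIndDeriv_nonpos hε)

lemma quarticInd_nonneg {ε : ℝ} (hε : 0 < ε) (y : ℝ) : 0 ≤ quarticInd ε y := by
  rw [← quarticInd_of_ge hε (le_max_right y ε)]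
  exact antitone_quarticInd hε (le_max_left y ε)

lemma quarticInd_le_one {ε : ℝ} (hε : 0 < ε) (y : ℝ) : quarticInd ε y ≤ 1 := by
  rw [← quarticInd_of_le_neg (min_le_right y (-ε))]
  exact antitone_quarticInd hε (min_le_left y (-ε))

/-- Outside `[-e, e]` the smoothed indicator is within `γ_ε(e)` of an integer. -/
lemma exists_int_abs_quarticInd_sub_le {ε e y : ℝ} (he : 0 < e) (heε : e < ε) (hy : e < |y|) :
    ∃ m : ℤ, |quarticInd ε y - m| ≤ quarticGamma ε e := by
  have hε : 0 < ε := he.trans heε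
  have habs : |e| ≤ ε := by rw [abs_of_pos he]; exact heε.le
  have h0 := quarticInd_nonneg hε y
  have h1 := quarticInd_le_one hε y
  rcases lt_abs.1 hy with h | h
  · have := antitone_quarticInd hε h.le
    rw [quarticInd_of_abs_le hε habs] at this
    exact ⟨0, by rw [Int.cast_zero, sub_zero, abs_of_nonneg h0]; exact this⟩
  · have := antitone_quarticInd hε (show y ≤ -e by linarith)
    rw [quarticInd_of_abs_le hε (by rwa [abs_neg]), quarticGamma_neg] at this
    exact ⟨1, by rw [Int.cast_one, abs_le]; constructor <;> linarith⟩

/-- For a non-integer level `c`, every family whose smoothed indicators sum to `c` has an entry in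
a fixed compact subinterval of `(-ε, ε)`. -/
lemma exists_radius_forall_exists_abs_le {ε c : ℝ} (hε : 0 < ε) (N : ℕ) (hc : ∀ k : ℤ, c ≠ k) :
    ∃ e, 0 < e ∧ e < ε ∧ ∀ y : Fin N → ℝ, ∑ i, quarticInd ε (y i) = c → ∃ i, |y i| ≤ e := by
  have hd : 0 < |c - round c| := abs_pos.2 (sub_ne_zero.2 (hc _))
  have hcont : ContinuousAt (fun e => N * quarticGamma ε e) ε :=
    (hasDerivAt_quarticGamma hε ε).continuousAt.const_mul _
  have hev : ∀ᶠ e in 𝓝 ε, N * quarticGamma ε e < |c - round c| := by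
    apply hcont.eventually_lt_const
    simpa [quarticGamma_self hε] using hd
  obtain ⟨e, ⟨hN, he⟩, heε⟩ := (((hev.and (lt_mem_nhds hε)).filter_mono
    nhdsWithin_le_nhds).and (self_mem_nhdsWithin (s := Set.Iio ε))).exists
  refine ⟨e, he, heε, fun y hy => ?_⟩
  by_contra! hfar
  choose m hm using fun i => exists_int_abs_quarticInd_sub_le he heε (hfar i)
  have h1 : |c - ((∑ i, m i : ℤ) : ℝ)| ≤ N * quarticGamma ε e := by
    rw [← hy, Int.cast_sum, ← Finset.sum_sub_distrib]
    refine (Finset.abs_sum_le_sum_abs _ _).trans ((Finset.sum_le_sum fun i _ => hm i).trans ?_)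
    simp
  have h2 := round_le c (∑ i, m i)
  linarith

lemma deriv_quarticGamma_neg_of_lt {ε e : ℝ} (he : 0 < e) (heε : e < ε) :
    deriv (quarticGamma ε) e < 0 := by
  have hε : 0 < ε := he.trans heε
  rw [(hasDerivAt_quarticGamma hε e).deriv, neg_div, neg_mul, neg_lt_zero]
  have : e / ε < 1 := (div_lt_one hε).2 heε
  have : 0 < 1 - (e / ε) ^ 2 := by nlinarith [div_pos he hε]
  positivity

lemma quarticIndDeriv_le_deriv_quarticGamma {ε e y : ℝ} (hε : 0 < ε) (heε : e < ε)
    (hy : |y| ≤ e) : quarticIndDeriv ε y ≤ deriv (quarticGamma ε) e := by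
  rw [(hasDerivAt_quarticGamma hε e).deriv, quarticIndDeriv_of_abs_le hε (hy.trans heε.le),
    neg_div, neg_mul, neg_mul, neg_le_neg_iff]
  have he : 0 ≤ e := (abs_nonneg y).trans hy
  have h1 : e / ε ≤ 1 := (div_le_one hε).2 heε.le
  have h2 : (y / ε) ^ 2 ≤ (e / ε) ^ 2 := by
    rw [sq_le_sq, abs_div, abs_div, abs_of_pos hε, abs_of_nonneg he]
    gcongr
  have h3 : 0 ≤ 1 - (e / ε) ^ 2 := by nlinarith [div_nonneg he hε.le]
  gcongr

/-- The map `(z, q) ↦ ∑ i, Γ_ε (z i - q)` is strictly differentiable. -/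
lemma hasStrictFDerivAt_sum_quarticInd {ε : ℝ} (hε : 0 < ε) {N : ℕ} (p : (Fin N → ℝ) × ℝ) :
    HasStrictFDerivAt (fun p : (Fin N → ℝ) × ℝ => ∑ i, quarticInd ε (p.1 i - p.2))
      (∑ i, quarticIndDeriv ε (p.1 i - p.2) •
        ((ContinuousLinearMap.proj i).comp (ContinuousLinearMap.fst ℝ (Fin N → ℝ) ℝ) -
          ContinuousLinearMap.snd ℝ (Fin N → ℝ) ℝ)) p := by
  refine HasStrictFDerivAt.fun_sum fun i _ => ?_
  have hlin := ((ContinuousLinearMap.proj (R := ℝ) (φ := fun _ : Fin N => ℝ) i).comp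
    (ContinuousLinearMap.fst ℝ (Fin N → ℝ) ℝ) -
      ContinuousLinearMap.snd ℝ (Fin N → ℝ) ℝ).hasStrictFDerivAt (x := p)
  exact (hasStrictDerivAt_quarticInd hε (p.1 i - p.2)).comp_hasStrictFDerivAt p hlin

/-- Two roots of the quantile equation coincide if the derivative is negative at each root. -/
lemma root_sum_quarticInd_unique {ε c : ℝ} (hε : 0 < ε) {N : ℕ} {z : Fin N → ℝ}
    (hneg : ∀ q, ∑ i, quarticInd ε (z i - q) = c → ∑ i, quarticIndDeriv ε (z i - q) < 0)
    {p q : ℝ} (hp : ∑ i, quarticInd ε (z i - p) = c) (hq : ∑ i, quarticInd ε (z i - q) = c) :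
    p = q := by
  wlog hpq : p < q generalizing p q
  · rcases (not_lt.1 hpq).eq_or_lt with h | h
    · exact h.symm
    · exact (this hq hp h).symm
  exfalso
  have hmono : Monotone fun q => ∑ i, quarticInd ε (z i - q) := fun a b hab =>
    Finset.sum_le_sum fun i _ => antitone_quarticInd hε (by linarith)
  have hder : HasDerivAt (fun q => ∑ i, quarticInd ε (z i - q))
      (∑ i, -quarticIndDeriv ε (z i - p)) p := by
    refine HasDerivAt.fun_sum fun i _ => ?_
    exact ((hasDerivAt_quarticInd hε (z i - p)).comp p
      ((hasDerivAt_id p).const_sub (z i))).congr_deriv (mul_neg_one _)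
  have hconst : HasDerivWithinAt (fun q => ∑ i, quarticInd ε (z i - q)) 0 (Set.Icc p q) p := by
    refine (hasDerivWithinAt_const p _ c).congr (fun x hx => ?_) hp
    exact le_antisymm (hq ▸ hmono hx.2) (hp ▸ hmono hx.1)
  have := (uniqueDiffOn_Icc hpq p ⟨le_rfl, hpq.le⟩).eq_deriv _ hder.hasDerivWithinAt hconst
  rw [Finset.sum_neg_distrib] at this
  linarith [hneg p hp]

/-- An implicitly defined real function whose defining equation has globally unique roots is
differentiable wherever the partial derivative does not vanish. -/
lemma differentiableAt_of_unique_root {E : Type*} [NormedAddCommGroup E] [NormedSpace ℝ E]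
    [CompleteSpace E] {F : E × ℝ → ℝ} {Q : E → ℝ} {z : E} {F' : E × ℝ →L[ℝ] ℝ}
    (hF : HasStrictFDerivAt F F' (z, Q z)) (hne : F' (0, 1) ≠ 0)
    (huniq : ∀ x q, F (x, q) = F (z, Q z) → q = Q x) : DifferentiableAt ℝ Q z := by
  have hinv : (F' ∘L .inr ℝ E ℝ).IsInvertible := by
    refine ⟨ContinuousLinearEquiv.unitsEquivAut ℝ (Units.mk0 _ hne), ?_⟩
    ext
    simp
  have hψ := (hF.hasStrictFDerivAt_implicitFunctionOfProdDomain hinv).hasFDerivAt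
  refine hψ.differentiableAt.congr_of_eventuallyEq ?_
  filter_upwards [hF.eventually_apply_implicitFunctionOfProdDomain hinv] with x hx
  exact (huniq x _ hx).symm

/-- For the smoothed quantile map `Q_ε : ℝ^N → ℝ` (unique root map of
`∑ i, Γ_ε (z i - Q) = (1-α)·N`, with `(1-α)·N ∉ ℤ`), there is `ε₀ ∈ (0, ε)` such that
for every `z`: (i) `∑ j, Γ_ε'(z j - Q_ε z) ≤ γ_ε'(ε₀) < 0`, and (ii) the gradient of
`Q_ε` at `z` is given componentwise by
`[∇Q_ε(z)]_i = Γ_ε'(z i - Q_ε z) / ∑ j, Γ_ε'(z j - Q_ε z)`, with each component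
in `[0,1]`. -/
theorem smoothed_quantile_gradient_formula
    (ε α : ℝ) (hε : 0 < ε) (hα : α ∈ Set.Ioo (0 : ℝ) 1) (N : ℕ)
    (hNotInt : ∀ k : ℤ, (1 - α) * (N : ℝ) ≠ (k : ℝ))
    (Q : (Fin N → ℝ) → ℝ)
    (hQ : ∀ z : Fin N → ℝ, ∑ i, quarticInd ε (z i - Q z) = (1 - α) * (N : ℝ)) :
    ∃ ε₀ : ℝ, 0 < ε₀ ∧ ε₀ < ε ∧
      ∀ z : Fin N → ℝ,
        ((∑ j, deriv (quarticInd ε) (z j - Q z) ≤ deriv (quarticGamma ε) ε₀) ∧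
          deriv (quarticGamma ε) ε₀ < 0) ∧
        ∀ i : Fin N,
          fderiv ℝ Q z (Pi.single i 1) =
            deriv (quarticInd ε) (z i - Q z) /
              (∑ j, deriv (quarticInd ε) (z j - Q z)) ∧
          fderiv ℝ Q z (Pi.single i 1) ∈ Set.Icc (0 : ℝ) 1 := by
  obtain ⟨e, he, heε, hball⟩ := exists_radius_forall_exists_abs_le hε N hNotInt
  have hle : ∀ (z : Fin N → ℝ) (q : ℝ), ∑ i, quarticInd ε (z i - q) = (1 - α) * (N : ℝ) →
      ∑ i, quarticIndDeriv ε (z i - q) ≤ deriv (quarticGamma ε) e := by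
    intro z q hq
    obtain ⟨i, hi⟩ := hball (fun i => z i - q) hq
    refine le_trans ?_ (quarticIndDeriv_le_deriv_quarticGamma hε heε hi)
    rw [← Finset.add_sum_erase _ _ (Finset.mem_univ i)]
    exact add_le_of_nonpos_right (Finset.sum_nonpos fun j _ => quarticIndDeriv_nonpos hε _)
  have hγ := deriv_quarticGamma_neg_of_lt he heε
  refine ⟨e, he, heε, fun z => ?_⟩
  simp only [fun y => (hasDerivAt_quarticInd hε y).deriv]
  have hneg := (hle z (Q z) (hQ z)).trans_lt hγ
  refine ⟨⟨hle z (Q z) (hQ z), hγ⟩, fun i => ?_⟩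
  have hF := hasStrictFDerivAt_sum_quarticInd hε (z, Q z)
  have hdiff : DifferentiableAt ℝ Q z := by
    refine differentiableAt_of_unique_root hF ?_ fun x q hx => ?_
    · simpa using hneg.ne
    · exact root_sum_quarticInd_unique hε (fun q hq => (hle x q hq).trans_lt hγ)
        (hx.trans (hQ z)) (hQ x)
  have hcomp := hF.hasFDerivAt.comp z ((hasFDerivAt_id z).prodMk hdiff.hasFDerivAt)
  have hzero := hcomp.unique ((hasFDerivAt_const ((1 - α) * (N : ℝ)) z).congr_of_eventuallyEq
    (Eventually.of_forall hQ))
  have happ := DFunLike.congr_fun hzero (Pi.single i 1)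
  simp [mul_sub, Finset.sum_sub_distrib, Pi.single_apply, ← Finset.sum_mul] at happ
  have hformula : fderiv ℝ Q z (Pi.single i 1) = quarticIndDeriv ε (z i - Q z) /
      ∑ j, quarticIndDeriv ε (z j - Q z) := by
    rw [eq_div_iff hneg.ne]
    linarith
  refine ⟨hformula, ?_⟩
  rw [hformula]
  refine ⟨div_nonneg_of_nonpos (quarticIndDeriv_nonpos hε _) hneg.le, ?_⟩
  rw [div_le_one_of_neg hneg, ← Finset.add_sum_erase _ _ (Finset.mem_univ i)]
  exact add_le_of_nonpos_right (Finset.sum_nonpos fun j _ => quarticIndDeriv_nonpos hε _)
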